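/- Let γ > 0 and let F : ℝ^d → ℝ be a nonnegative continuously differentiable function satisfying condition (FF): there exist C₀ > 0 and ϑ ∈ (0,1) such that (1/2)⟨x, ∇F(x)⟩ ≥ ϑ F(x) + γ² ϑ(2−ϑ)/(8(1−ϑ)) |x|² − C₀ for all x ∈ ℝ^d. Then there exist positive constants c₀ and K₁ such that for all x, v ∈ ℝ^d, d/2 − (γ/2)|v|² − (γ/2)⟨x, ∇F(x)⟩ ≤ −c₀ ℋ(x,v) + K₁, where ℋ(x,v) := (1/2)|v|² + F(x) + (γ/2)⟨x,v⟩ + (γ²/4)|x|² + 1. (Equivalently, ℋ is a Lyapunov function for the Langevin generator: ℒℋ ≤ −c₀ℋ + K₁.) -/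

import Mathlib

open scoped RealInnerProductSpace

/-- Let γ > 0 and let F : ℝ^d → ℝ be a nonnegative continuously differentiable function
satisfying condition (FF): there exist C₀ > 0 and ϑ ∈ (0,1) such that
(1/2)⟨x, ∇F(x)⟩ ≥ ϑ F(x) + γ² ϑ(2−ϑ)/(8(1−ϑ)) |x|² − C₀ for all x ∈ ℝ^d.
Then there exist positive constants c₀ and K₁ such that for all x, v ∈ ℝ^d,
d/2 − (γ/2)|v|² − (γ/2)⟨x, ∇F(x)⟩ ≤ −c₀ ℋ(x,v) + K₁, where
ℋ(x,v) := (1/2)|v|² + F(x) + (γ/2)⟨x,v⟩ + (γ²/4)|x|² + 1. -/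
theorem stmt_6 (d : ℕ) (hd : 1 ≤ d) (γ : ℝ) (hγ : 0 < γ)
    (F : EuclideanSpace ℝ (Fin d) → ℝ) (hFnn : ∀ x, 0 ≤ F x)
    (F' : EuclideanSpace ℝ (Fin d) → EuclideanSpace ℝ (Fin d))
    (hF : ∀ x, HasGradientAt F (F' x) x) (hF' : Continuous F')
    (C₀ ϑ : ℝ) (hC₀ : 0 < C₀) (hϑ : ϑ ∈ Set.Ioo (0 : ℝ) 1)
    (hFF : ∀ x : EuclideanSpace ℝ (Fin d),
      ϑ * F x + γ ^ 2 * (ϑ * (2 - ϑ) / (8 * (1 - ϑ))) * ‖x‖ ^ 2 - C₀ ≤ 1 / 2 * ⟪x, F' x⟫) :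
    ∃ c₀ > (0 : ℝ), ∃ K₁ > (0 : ℝ), ∀ x v : EuclideanSpace ℝ (Fin d),
      (d : ℝ) / 2 - γ / 2 * ‖v‖ ^ 2 - γ / 2 * ⟪x, F' x⟫
        ≤ -c₀ * (1 / 2 * ‖v‖ ^ 2 + F x + γ / 2 * ⟪x, v⟫ + γ ^ 2 / 4 * ‖x‖ ^ 2 + 1) + K₁ := by
  obtain ⟨hϑ0, hϑ1⟩ := hϑ
  have h1 : 0 < 1 - ϑ := sub_pos.mpr hϑ1
  refine ⟨γ * ϑ, mul_pos hγ hϑ0, γ * ϑ + γ * C₀ + d / 2, by positivity, fun x v => ?_⟩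
  have hquad : 0 ≤ γ * ((1 - ϑ) / 2) * ‖v - (ϑ * γ / (2 * (1 - ϑ))) • x‖ ^ 2 := by positivity
  rw [norm_sub_sq_real, inner_smul_right, norm_smul, mul_pow, Real.norm_eq_abs, sq_abs,
    real_inner_comm] at hquad
  have hdrift := mul_le_mul_of_nonneg_left (hFF x) hγ.le
  have hexpand : γ * ((1 - ϑ) / 2) * (‖v‖ ^ 2 - 2 * (ϑ * γ / (2 * (1 - ϑ)) * ⟪x, v⟫)
        + (ϑ * γ / (2 * (1 - ϑ))) ^ 2 * ‖x‖ ^ 2)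
      = γ * ((1 - ϑ) / 2 * ‖v‖ ^ 2 - ϑ * γ / 2 * ⟪x, v⟫
        + γ ^ 2 * (ϑ * (2 - ϑ) / (8 * (1 - ϑ))) * ‖x‖ ^ 2 - γ ^ 2 * ϑ / 4 * ‖x‖ ^ 2) := by
    field_simp
    ring
  rw [hexpand] at hquad
  linarith
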